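/- arXiv:2006.13193 — 6 statements merged into one kernel-verified Lean document; each statement's English description precedes it below -/
import Mathlib

section
/- (Fourier slice theorem.) Let n ≥ 1, let f : ℝⁿ → ℝ be smooth with compact support, let θ ∈ ℝⁿ be a unit vector, and let σ ∈ ℝ. Then the one-dimensional Fourier transform in η of the Radon transform of f equals the n-dimensional Fourier transform of f evaluated at σθ: ∫_ℝ e^{−i η σ} (Rf)(θ, η) dη = ∫_{ℝⁿ} e^{−i σ (x·θ)} f(x) dx. -/
open MeasureTheory Real
open scoped RealInnerProductSpace

/-- The Radon transform of `f : ℝⁿ → ℝ`: for a unit vector `θ` and `η ∈ ℝ`,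
`(Rf)(θ, η) = ∫_{y ∈ θ^⊥} f(ηθ + y) dy`, an integral over the hyperplane
`{x : x·θ = η}` with respect to the Lebesgue measure of the orthogonal
complement `θ^⊥`. -/
noncomputable def radonTransform {n : ℕ} (f : EuclideanSpace ℝ (Fin n) → ℝ)
    (θ : EuclideanSpace ℝ (Fin n)) (η : ℝ) : ℝ :=
  ∫ y : (ℝ ∙ θ)ᗮ, f (η • θ + (y : EuclideanSpace ℝ (Fin n)))

theorem slice_mp {n : ℕ} (θ : EuclideanSpace ℝ (Fin n)) (hθ : ‖θ‖ = 1) :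
    MeasurePreserving (fun p : ℝ × (ℝ ∙ θ)ᗮ => p.1 • θ + (p.2 : EuclideanSpace ℝ (Fin n)))
      (volume.prod volume) volume := by
  have h1 := (LinearIsometryEquiv.toSpanUnitSingleton (𝕜 := ℝ) θ hθ).measurePreserving
  have h2 := h1.prod (MeasurePreserving.id (volume : Measure (ℝ ∙ θ)ᗮ))
  have h3 := (WithLp.volume_preserving_toLp (ℝ ∙ θ) (ℝ ∙ θ)ᗮ).comp h2
  have h4 := (ℝ ∙ θ).orthogonalDecomposition.symm.measurePreserving.comp h3
  convert! h4 using 1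

/-- **Fourier slice theorem.** For `f` smooth with compact support, a unit
vector `θ` and `σ ∈ ℝ`, the one-dimensional Fourier transform in `η` of the
Radon transform `(Rf)(θ, ·)` equals the `n`-dimensional Fourier transform of
`f` at `σθ`:
`∫_ℝ e^{-iησ} (Rf)(θ, η) dη = ∫_{ℝⁿ} e^{-iσ(x·θ)} f(x) dx`. -/
theorem fourier_slice
    (n : ℕ) (hn : 1 ≤ n)
    (f : EuclideanSpace ℝ (Fin n) → ℝ) (hf : ContDiff ℝ (⊤ : ℕ∞) f)
    (hsupp : HasCompactSupport f)
    (θ : EuclideanSpace ℝ (Fin n)) (hθ : ‖θ‖ = 1) (σ : ℝ) :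
    ∫ η : ℝ, Complex.exp (-Complex.I * (η * σ)) * (radonTransform f θ η : ℂ)
      = ∫ x : EuclideanSpace ℝ (Fin n),
          Complex.exp (-Complex.I * (σ * (⟪x, θ⟫ : ℝ))) * (f x : ℂ) := by
  have hmp := slice_mp θ hθ
  have hc : Continuous (fun x : EuclideanSpace ℝ (Fin n) =>
      Complex.exp (-Complex.I * (σ * (⟪x, θ⟫ : ℝ))) * (f x : ℂ)) := by
    have := hf.continuous
    fun_prop
  have hs : HasCompactSupport (fun x : EuclideanSpace ℝ (Fin n) =>
      Complex.exp (-Complex.I * (σ * (⟪x, θ⟫ : ℝ))) * (f x : ℂ)) := by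
    refine HasCompactSupport.mul_left ?_
    exact hsupp.comp_left (g := fun r : ℝ => (r : ℂ)) (by simp)
  have hi := hc.integrable_of_hasCompactSupport (μ := volume) hs
  have hi2 := hmp.integrable_comp_of_integrable hi
  conv_rhs => rw [← hmp.map_eq]
  rw [integral_map hmp.measurable.aemeasurable hc.aestronglyMeasurable]
  refine Eq.trans ?_ (integral_prod _ hi2).symm
  simp only [Function.comp_apply]
  refine integral_congr_ae (Filter.Eventually.of_forall fun η => ?_)
  simp only [radonTransform]
  rw [← integral_complex_ofReal, ← integral_const_mul]
  refine integral_congr_ae (Filter.Eventually.of_forall fun y => ?_)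
  have hy : ⟪(y : EuclideanSpace ℝ (Fin n)), θ⟫ = 0 := by
    rw [real_inner_comm]
    exact Submodule.mem_orthogonal_singleton_iff_inner_right.mp y.2
  have : ⟪η • θ + (y : EuclideanSpace ℝ (Fin n)), θ⟫ = η := by
    rw [inner_add_left, hy, real_inner_smul_left, real_inner_self_eq_norm_sq, hθ]; simp
  simp only [this]
  rw [mul_comm (η : ℂ) σ]
end

section
/- Let s ∈ ℕ and M > 0. There exists κ₀ ∈ (0, 1) such that for every κ ∈ (0, κ₀) there exists a constant C > 0 (depending on s, M and κ but independent of δ) such that for every δ ∈ (0, M) there exist ε > 0 and τ ≥ 1 satisfying both ε · τ^{(s+2)/2} ≤ κ and 2 τ^{−1/2} + (κ³ δ / (2M)) ε^{−2} + ε · τ^{(3/2)s + 3} ≤ C · δ^{1/(6s + 15)}. -/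
open Real

/-- **Optimization of the parameters `ε` and `τ` (case `m = 2`, `n = 1`).**
For `s ∈ ℕ` and `M > 0` there is `κ₀ ∈ (0,1)` such that for every
`κ ∈ (0, κ₀)` there is a constant `C > 0` (independent of `δ`) such that for
every `δ ∈ (0, M)` one can choose `ε > 0` and `τ ≥ 1` with
`ε τ^{(s+2)/2} ≤ κ` and
`2τ^{-1/2} + (κ³δ/(2M)) ε^{-2} + ε τ^{(3/2)s+3} ≤ C δ^{1/(6s+15)}`. -/
theorem parameter_optimization_m2
    (s : ℕ) (M : ℝ) (hM : 0 < M) :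
    ∃ κ₀ : ℝ, κ₀ ∈ Set.Ioo (0 : ℝ) 1 ∧
      ∀ κ ∈ Set.Ioo (0 : ℝ) κ₀, ∃ C : ℝ, 0 < C ∧
        ∀ δ ∈ Set.Ioo (0 : ℝ) M, ∃ ε : ℝ, 0 < ε ∧ ∃ τ : ℝ, 1 ≤ τ ∧
          ε * τ ^ (((s : ℝ) + 2) / 2) ≤ κ ∧
          2 * τ ^ (-(1 : ℝ) / 2) + (κ ^ 3 * δ / (2 * M)) * ε ^ (-(2 : ℝ))
              + ε * τ ^ ((3 / 2 : ℝ) * (s : ℝ) + 3)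
            ≤ C * δ ^ ((1 : ℝ) / (6 * (s : ℝ) + 15)) := by
  refine ⟨1 / 2, ⟨by norm_num, by norm_num⟩, ?_⟩
  rintro κ ⟨hκ, hκ1⟩
  have hq : (0 : ℝ) < 6 * (s : ℝ) + 15 := by positivity
  refine ⟨4 * (M ^ ((1 : ℝ) / (6 * (s : ℝ) + 15)))⁻¹, by positivity, ?_⟩
  rintro δ ⟨hδ, hδM⟩
  obtain ⟨t, ht⟩ : ∃ t : ℝ, t = (δ / M) ^ ((1 : ℝ) / (6 * (s : ℝ) + 15)) := ⟨_, rfl⟩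
  have hdm : 0 < δ / M := by positivity
  have ht0 : 0 < t := by rw [ht]; positivity
  have ht1 : t ≤ 1 := by
    rw [ht]
    exact Real.rpow_le_one hdm.le ((div_le_one hM).2 hδM.le) (by positivity)
  have hδt : δ = M * t ^ (6 * (s : ℝ) + 15) := by
    rw [ht, ← Real.rpow_mul hdm.le, one_div, inv_mul_cancel₀ hq.ne', Real.rpow_one]
    field_simp
  have hR : 4 * (M ^ ((1 : ℝ) / (6 * (s : ℝ) + 15)))⁻¹ * δ ^ ((1 : ℝ) / (6 * (s : ℝ) + 15))
      = 4 * t := by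
    rw [ht, Real.div_rpow hδ.le hM.le, div_eq_mul_inv]
    ring
  have hs : (0 : ℝ) ≤ s := Nat.cast_nonneg s
  rw [hR]
  refine ⟨κ * t ^ (3 * (s : ℝ) + 7), by positivity, t ^ (-2 : ℝ),
    Real.one_le_rpow_of_pos_of_le_one_of_nonpos ht0 ht1 (by norm_num), ?_, ?_⟩
  · rw [← Real.rpow_mul ht0.le, mul_assoc, ← Real.rpow_add ht0]
    have : t ^ (3 * (s : ℝ) + 7 + -2 * (((s : ℝ) + 2) / 2)) ≤ 1 :=
      Real.rpow_le_one ht0.le ht1 (by linarith)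
    nlinarith
  · have e1 : (t ^ (-2 : ℝ)) ^ (-(1 : ℝ) / 2) = t := by
      rw [← Real.rpow_mul ht0.le]
      norm_num
    have e3 : κ * t ^ (3 * (s : ℝ) + 7) * (t ^ (-2 : ℝ)) ^ ((3 / 2 : ℝ) * (s : ℝ) + 3) = κ * t := by
      rw [← Real.rpow_mul ht0.le, mul_assoc, ← Real.rpow_add ht0]
      have : 3 * (s : ℝ) + 7 + -2 * ((3 / 2 : ℝ) * (s : ℝ) + 3) = 1 := by ring
      rw [this, Real.rpow_one]
    have e2 : (κ ^ 3 * δ / (2 * M)) * (κ * t ^ (3 * (s : ℝ) + 7)) ^ (-(2 : ℝ)) = κ / 2 * t := by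
      have h1 : t ^ (6 * (s : ℝ) + 15) = (t ^ (3 * (s : ℝ) + 7)) ^ 2 * t := by
        rw [← Real.rpow_natCast, ← Real.rpow_mul ht0.le]
        nth_rewrite 3 [← Real.rpow_one t]
        rw [← Real.rpow_add ht0]
        congr 1
        push_cast
        ring
      have hp : 0 < t ^ (3 * (s : ℝ) + 7) := by positivity
      have hp2 : 0 < κ * t ^ (3 * (s : ℝ) + 7) := by positivity
      rw [Real.rpow_neg hp2.le, Real.rpow_two, hδt, h1]
      generalize t ^ (3 * (s : ℝ) + 7) = p at *
      field_simp
    rw [e1, e2, e3]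
    nlinarith
end

section
/- Let m ≥ 2 be an integer, let s ∈ ℕ, and let M > 0. There exists κ₀ ∈ (0, 1) such that for every κ ∈ (0, κ₀) there exists a constant C > 0 (depending on s, m, M and κ but independent of δ) such that for every δ ∈ (0, M) there exist ε > 0 and τ ≥ 1 satisfying both ε · τ^{(s+2)/2} ≤ κ and 2 τ^{−1/2} + (κ^{2m−1} δ / (m M)) ε^{−m} + (1/(m−1)) ε^{m−1} · τ^{((s+2)/2)(2m−1)} ≤ C · δ^{(m−1)/((2m−1)(m(s+2)+1))}. -/
open Real

/-- **Optimization of the parameters `ε` and `τ` (general `m ≥ 2`).**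
For an integer `m ≥ 2`, `s ∈ ℕ` and `M > 0` there is `κ₀ ∈ (0,1)` such that
for every `κ ∈ (0, κ₀)` there is a constant `C > 0` (independent of `δ`) such
that for every `δ ∈ (0, M)` one can choose `ε > 0` and `τ ≥ 1` with
`ε τ^{(s+2)/2} ≤ κ` and
`2τ^{-1/2} + (κ^{2m-1}δ/(mM)) ε^{-m} + (1/(m-1)) ε^{m-1} τ^{((s+2)/2)(2m-1)}`
`≤ C δ^{(m-1)/((2m-1)(m(s+2)+1))}`. -/
theorem parameter_optimization
    (m : ℕ) (hm : 2 ≤ m) (s : ℕ) (M : ℝ) (hM : 0 < M) :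
    ∃ κ₀ : ℝ, κ₀ ∈ Set.Ioo (0 : ℝ) 1 ∧
      ∀ κ ∈ Set.Ioo (0 : ℝ) κ₀, ∃ C : ℝ, 0 < C ∧
        ∀ δ ∈ Set.Ioo (0 : ℝ) M, ∃ ε : ℝ, 0 < ε ∧ ∃ τ : ℝ, 1 ≤ τ ∧
          ε * τ ^ (((s : ℝ) + 2) / 2) ≤ κ ∧
          2 * τ ^ (-(1 : ℝ) / 2)
              + (κ ^ (2 * m - 1) * δ / ((m : ℝ) * M)) * ε ^ (-(m : ℝ))
              + (1 / ((m : ℝ) - 1)) * ε ^ (m - 1)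
                  * τ ^ ((((s : ℝ) + 2) / 2) * (2 * (m : ℝ) - 1))
            ≤ C * δ ^ (((m : ℝ) - 1) /
                ((2 * (m : ℝ) - 1) * ((m : ℝ) * ((s : ℝ) + 2) + 1))) := by
  have hm' : (2 : ℝ) ≤ (m : ℝ) := by exact_mod_cast hm
  have hs' : (0 : ℝ) ≤ (s : ℝ) := Nat.cast_nonneg s
  have hcast : ((m - 1 : ℕ) : ℝ) = (m : ℝ) - 1 := by
    rw [Nat.cast_sub (by omega)]; simp
  generalize hθ : ((m : ℝ) - 1) / ((2 * (m : ℝ) - 1) * ((m : ℝ) * ((s : ℝ) + 2) + 1)) = θ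
  have hD1 : (0 : ℝ) < 2 * (m : ℝ) - 1 := by linarith
  have hD2 : (0 : ℝ) < (m : ℝ) * ((s : ℝ) + 2) + 1 := by positivity
  have hm1 : (0 : ℝ) < (m : ℝ) - 1 := by linarith
  have hm0 : (0 : ℝ) < (m : ℝ) := by linarith
  have hθ0 : 0 < θ := by rw [← hθ]; positivity
  have hθe : θ * ((2 * (m : ℝ) - 1) * ((m : ℝ) * ((s : ℝ) + 2) + 1)) = (m : ℝ) - 1 := by
    rw [← hθ]; exact div_mul_cancel₀ _ (mul_pos hD1 hD2).ne'
  obtain ⟨e, he⟩ : ∃ e : ℝ, e = (1 - θ) / m := ⟨_, rfl⟩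
  have he1 : (m : ℝ) * e = 1 - θ := by rw [he]; field_simp
  have he2 : ((m : ℝ) - 1) * e = θ * (1 + ((s : ℝ) + 2) * (2 * (m : ℝ) - 1)) := by
    apply mul_left_cancel₀ hm0.ne'
    linear_combination ((m : ℝ) - 1) * he1 - hθe
  have he3 : ((s : ℝ) + 2) * θ ≤ e := by
    have h : ((m : ℝ) - 1) * (((s : ℝ) + 2) * θ) ≤ ((m : ℝ) - 1) * e := by
      rw [he2]
      have : 0 ≤ ((s : ℝ) + 2) * θ * m := by positivity
      nlinarith
    exact le_of_mul_le_mul_left h hm1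
  refine ⟨1 / 2, by norm_num, ?_⟩
  rintro κ ⟨hκ, -⟩
  refine ⟨(2 + κ ^ (2 * m - 1) * κ ^ (-(m : ℝ)) / m + κ ^ (m - 1) / ((m : ℝ) - 1)) * M ^ (-θ),
    by positivity, ?_⟩
  rintro δ ⟨hδ, hδM⟩
  obtain ⟨t, ht⟩ : ∃ t : ℝ, t = δ / M := ⟨_, rfl⟩
  have ht0 : 0 < t := by rw [ht]; positivity
  have ht1 : t ≤ 1 := by rw [ht, div_le_one hM]; exact hδM.le
  have hδt : δ = t * M := by rw [ht]; field_simp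
  refine ⟨κ * t ^ e, by positivity, t ^ (-2 * θ), ?_, ?_, le_of_eq ?_⟩
  · exact Real.one_le_rpow_of_pos_of_le_one_of_nonpos ht0 ht1 (by linarith)
  · rw [← Real.rpow_mul ht0.le, mul_assoc, ← Real.rpow_add ht0]
    have := Real.rpow_le_one ht0.le ht1
      (show 0 ≤ e + -2 * θ * (((s : ℝ) + 2) / 2) by linarith)
    nlinarith
  · have h1 : (t ^ (-2 * θ)) ^ (-(1 : ℝ) / 2) = t ^ θ := by
      rw [← Real.rpow_mul ht0.le]; congr 1; ring
    have h2 : δ * (κ * t ^ e) ^ (-(m : ℝ)) = M * κ ^ (-(m : ℝ)) * t ^ θ := by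
      rw [Real.mul_rpow hκ.le (by positivity), ← Real.rpow_mul ht0.le,
        show θ = 1 + e * -(m : ℝ) by linarith, Real.rpow_add ht0, Real.rpow_one, hδt]
      ring
    have h3 : (κ * t ^ e) ^ (m - 1) *
        (t ^ (-2 * θ)) ^ ((((s : ℝ) + 2) / 2) * (2 * (m : ℝ) - 1)) = κ ^ (m - 1) * t ^ θ := by
      rw [mul_pow, ← Real.rpow_natCast (t ^ e), hcast, ← Real.rpow_mul ht0.le,
        ← Real.rpow_mul ht0.le, mul_assoc, ← Real.rpow_add ht0]
      congr 2
      linear_combination he2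
    have h4 : M ^ (-θ) * δ ^ θ = t ^ θ := by
      rw [ht, Real.div_rpow hδ.le hM.le, Real.rpow_neg hM.le]; ring
    rw [h1, mul_assoc (1 / ((m : ℝ) - 1)), h3, mul_assoc _ (M ^ (-θ)), h4,
      show κ ^ (2 * m - 1) * δ / ((m : ℝ) * M) * (κ * t ^ e) ^ (-(m : ℝ))
        = κ ^ (2 * m - 1) / ((m : ℝ) * M) * (δ * (κ * t ^ e) ^ (-(m : ℝ))) by ring, h2]
    field_simp
end

section
/- Let α > 0 and let χ : ℝ → ℝ be smooth with compact support contained in [−α, α] and |χ| ≤ 1. For τ ≥ 1 define H_τ(l) = χ(l) · τ^{1/2} · e^{−τ l²/2}. Let Ω ⊂ ℝ be a bounded open interval, let T > 0, and let k ∈ ℕ. Then there exists a constant C > 0, depending on χ, Ω, T and k but not on τ or c₀, such that for all τ ≥ 1 and all c₀ ∈ ℝ: ∫_Ω ∫_0^T |H_τ^{(k)}(x − t + c₀)|² dt dx ≤ C · τ^{k + 1/2}, where H_τ^{(k)} denotes the k-th derivative of H_τ. -/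
open MeasureTheory Real

lemma wp_poly_bound (p : Polynomial ℝ) :
    ∃ C : ℝ, 0 ≤ C ∧ ∀ u : ℝ, |p.eval u| * Real.exp (-u ^ 2 / 4) ≤ C := by
  induction p using Polynomial.induction_on' with
  | add p q hp hq =>
    obtain ⟨C, hC, h1⟩ := hp
    obtain ⟨D, hD, h2⟩ := hq
    refine ⟨C + D, by positivity, fun u => ?_⟩
    have h3 := h1 u
    have h4 := h2 u
    have h5 : |(p + q).eval u| ≤ |p.eval u| + |q.eval u| := by
      rw [Polynomial.eval_add]; exact abs_add_le _ _
    have h6 := mul_le_mul_of_nonneg_right h5 (Real.exp_pos (-u ^ 2 / 4)).le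
    linarith
  | monomial n a =>
    refine ⟨|a| * (n.factorial * Real.exp 1), by positivity, fun u => ?_⟩
    rw [Polynomial.eval_monomial, abs_mul, abs_pow, mul_assoc]
    apply mul_le_mul_of_nonneg_left _ (abs_nonneg a)
    have h1 := Real.pow_div_factorial_le_exp |u| (abs_nonneg u) n
    have hf : (0 : ℝ) < n.factorial := by positivity
    rw [div_le_iff₀ hf] at h1
    calc |u| ^ n * Real.exp (-u ^ 2 / 4)
        ≤ (Real.exp |u| * n.factorial) * Real.exp (-u ^ 2 / 4) := by gcongr
      _ = n.factorial * Real.exp (|u| + -u ^ 2 / 4) := by rw [Real.exp_add]; ring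
      _ ≤ n.factorial * Real.exp 1 := by
        gcongr
        rw [← sq_abs u]
        nlinarith [sq_nonneg (|u| - 2)]

lemma wp_hasDeriv (χ : ℝ → ℝ) (hχ : ContDiff ℝ (⊤ : ℕ∞) χ) (p : Polynomial ℝ) (s : ℝ) :
    deriv (fun l : ℝ => χ l * p.eval (s * l) * Real.exp (-(s * l) ^ 2 / 2)) =
      (fun l : ℝ => deriv χ l * p.eval (s * l) * Real.exp (-(s * l) ^ 2 / 2)) +
      (fun l : ℝ => s * (χ l * (Polynomial.derivative p - Polynomial.X * p).eval (s * l)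
        * Real.exp (-(s * l) ^ 2 / 2))) := by
  funext l
  have h0 : HasDerivAt χ (deriv χ l) l :=
    ((hχ.differentiable (by simp)) l).hasDerivAt
  have h1 : HasDerivAt (fun l : ℝ => s * l) s l := by
    simpa using (hasDerivAt_id l).const_mul s
  have h2 : HasDerivAt (fun l : ℝ => p.eval (s * l))
      ((Polynomial.derivative p).eval (s * l) * s) l :=
    (p.hasDerivAt (s * l)).comp l h1
  have h3 := (((h1.pow 2).neg).div_const 2).exp
  have h4 := ((h0.mul h2).mul h3).deriv
  refine Eq.trans h4 ?_
  simp
  ring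

lemma wp_smooth (χ : ℝ → ℝ) (hχ : ContDiff ℝ (⊤ : ℕ∞) χ) (p : Polynomial ℝ) (s : ℝ) :
    ContDiff ℝ (⊤ : ℕ∞) (fun l : ℝ => χ l * p.eval (s * l) * Real.exp (-(s * l) ^ 2 / 2)) := by
  have h : ContDiff ℝ (⊤ : ℕ∞) (fun l : ℝ => p.eval (s * l)) := by
    have := (p.contDiff_aeval ((⊤ : ℕ∞) : WithTop ℕ∞) (𝕜 := ℝ) (R := ℝ)).comp
      (contDiff_const.mul contDiff_id : ContDiff ℝ (⊤ : ℕ∞) (fun l : ℝ => s * l))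
    simpa [Function.comp_def, Polynomial.aeval_def, Polynomial.eval₂_eq_eval_map] using this
  have h' : ContDiff ℝ (⊤ : ℕ∞) (fun l : ℝ => Real.exp (-(s * l) ^ 2 / 2)) := by fun_prop
  exact (hχ.mul h).mul h'

lemma wp_pointwise (k : ℕ) : ∀ (χ : ℝ → ℝ), ContDiff ℝ (⊤ : ℕ∞) χ → HasCompactSupport χ →
    ∀ p : Polynomial ℝ, ∃ C : ℝ, 0 ≤ C ∧ ∀ s : ℝ, 1 ≤ s → ∀ l : ℝ,
      |iteratedDeriv k (fun l : ℝ => χ l * p.eval (s * l) * Real.exp (-(s * l) ^ 2 / 2)) l|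
        ≤ C * s ^ k * Real.exp (-(s * l) ^ 2 / 4) := by
  induction k with
  | zero =>
    intro χ hχ hc p
    obtain ⟨M, hM⟩ := hc.exists_bound_of_continuous hχ.continuous
    obtain ⟨C, hC, hp⟩ := wp_poly_bound p
    have hM0 : 0 ≤ M := (norm_nonneg _).trans (hM 0)
    refine ⟨M * C, by positivity, fun s _ l => ?_⟩
    rw [iteratedDeriv_zero, abs_mul, abs_mul, abs_of_pos (Real.exp_pos _)]
    have h1 := hp (s * l)
    have h2 : |χ l| ≤ M := hM l
    have h3 : Real.exp (-(s * l) ^ 2 / 2) =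
        Real.exp (-(s * l) ^ 2 / 4) * Real.exp (-(s * l) ^ 2 / 4) := by
      rw [← Real.exp_add]; congr 1; ring
    calc |χ l| * |p.eval (s * l)| * Real.exp (-(s * l) ^ 2 / 2)
        = |χ l| * (|p.eval (s * l)| * Real.exp (-(s * l) ^ 2 / 4))
          * Real.exp (-(s * l) ^ 2 / 4) := by rw [h3]; ring
      _ ≤ M * C * Real.exp (-(s * l) ^ 2 / 4) := by gcongr
      _ = _ := by ring
  | succ k ih =>
    intro χ hχ hc p
    have hχ' : ContDiff ℝ (⊤ : ℕ∞) (deriv χ) := by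
      exact (contDiff_infty_iff_deriv.1 hχ).2
    obtain ⟨C, hC, h1⟩ := ih (deriv χ) hχ' hc.deriv p
    obtain ⟨D, hD, h2⟩ := ih χ hχ hc (Polynomial.derivative p - Polynomial.X * p)
    refine ⟨C + D, by positivity, fun s hs l => ?_⟩
    have hle : (k : WithTop ℕ∞) ≤ ((⊤ : ℕ∞) : WithTop ℕ∞) := by exact_mod_cast le_top
    have c1 := ((wp_smooth (deriv χ) hχ' p s).of_le hle).contDiffAt (x := l)
    have c2 := ((wp_smooth χ hχ (Polynomial.derivative p - Polynomial.X * p) s).of_le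
      hle).contDiffAt (x := l)
    rw [iteratedDeriv_succ', wp_hasDeriv χ hχ p s, iteratedDeriv_add c1 (contDiffAt_const.mul c2),
      iteratedDeriv_const_mul_field]
    have e1 := h1 s hs l
    have e2 := h2 s hs l
    have hs0 : 0 ≤ s := by linarith
    refine (abs_add_le _ _).trans ?_
    rw [abs_mul, abs_of_nonneg hs0]
    have e3 := mul_le_mul_of_nonneg_left e2 hs0
    have e4 : C * s ^ k * Real.exp (-(s * l) ^ 2 / 4)
        ≤ C * s ^ (k + 1) * Real.exp (-(s * l) ^ 2 / 4) := by
      gcongr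
      omega
    calc _ ≤ C * s ^ (k + 1) * Real.exp (-(s * l) ^ 2 / 4)
          + s * (D * s ^ k * Real.exp (-(s * l) ^ 2 / 4)) := add_le_add (e1.trans e4) e3
      _ = _ := by ring

/-- **`L²` space–time estimate for derivatives of Gaussian wave packets
(`1+1` dimensions).** Let `χ` be smooth, supported in `[-α, α]`, with
`|χ| ≤ 1`, and for `τ ≥ 1` let `H_τ(l) = χ(l) τ^{1/2} e^{-τl²/2}`. Then for a
bounded open interval `Ω = (a,b)`, a time `T > 0` and `k ∈ ℕ`, there is
`C > 0` independent of `τ ≥ 1` and of the shift `c₀` such that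
`∫_Ω ∫_0^T |H_τ^{(k)}(x - t + c₀)|² dt dx ≤ C τ^{k + 1/2}`. -/
theorem wave_packet_L2_estimate_1D
    (α : ℝ) (hα : 0 < α) (χ : ℝ → ℝ) (hχ : ContDiff ℝ (⊤ : ℕ∞) χ)
    (hχsupp : Function.support χ ⊆ Set.Icc (-α) α)
    (hχbd : ∀ l : ℝ, |χ l| ≤ 1)
    (a b T : ℝ) (hab : a < b) (hT : 0 < T) (k : ℕ) :
    ∃ C : ℝ, 0 < C ∧ ∀ τ : ℝ, 1 ≤ τ → ∀ c₀ : ℝ,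
      ∫ x in Set.Ioo a b, ∫ t in Set.Ioc (0 : ℝ) T,
          (iteratedDeriv k
              (fun l : ℝ => χ l * τ ^ ((1 : ℝ) / 2) * Real.exp (-τ * l ^ 2 / 2))
              (x - t + c₀)) ^ 2
        ≤ C * τ ^ ((k : ℝ) + 1 / 2) := by
  have hc : HasCompactSupport χ :=
    HasCompactSupport.of_support_subset_isCompact isCompact_Icc hχsupp
  obtain ⟨C, hC, hb⟩ := wp_pointwise k χ hχ hc 1
  have hba : 0 < b - a := sub_pos.2 hab
  refine ⟨(C ^ 2 * √(2 * π) + 1) * (b - a), by positivity, fun τ hτ c₀ => ?_⟩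
  have hτ0 : 0 < τ := by linarith
  set F := iteratedDeriv k
    (fun l : ℝ => χ l * τ ^ ((1 : ℝ) / 2) * Real.exp (-τ * l ^ 2 / 2)) with hF
  have hs1 : 1 ≤ √τ := Real.one_le_sqrt.2 hτ
  have hss : √τ ^ 2 = τ := Real.sq_sqrt hτ0.le
  have key : ∀ l, F l ^ 2 ≤ C ^ 2 * τ ^ (k + 1) * Real.exp (-(τ / 2) * l ^ 2) := by
    intro l
    have hfun : (fun l : ℝ => χ l * τ ^ ((1 : ℝ) / 2) * Real.exp (-τ * l ^ 2 / 2)) =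
        fun l => √τ * (χ l * (1 : Polynomial ℝ).eval (√τ * l)
          * Real.exp (-(√τ * l) ^ 2 / 2)) := by
      funext l
      rw [mul_pow, hss, Polynomial.eval_one, Real.sqrt_eq_rpow, neg_mul]
      ring
    rw [hF, hfun, iteratedDeriv_const_mul_field, mul_pow, hss]
    have h1 := pow_le_pow_left₀ (abs_nonneg _) (hb √τ hs1 l) 2
    rw [sq_abs] at h1
    have h2 := mul_le_mul_of_nonneg_left h1 hτ0.le
    refine h2.trans (le_of_eq ?_)
    have h3 : Real.exp (-(√τ * l) ^ 2 / 4) ^ 2 = Real.exp (-(τ / 2) * l ^ 2) := by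
      rw [← Real.exp_nat_mul, mul_pow, hss]; congr 1; push_cast; ring
    rw [mul_pow, mul_pow, h3, ← pow_mul, mul_comm k 2, pow_mul, hss]
    ring
  have hg : Integrable (fun l : ℝ => C ^ 2 * τ ^ (k + 1) * Real.exp (-(τ / 2) * l ^ 2)) :=
    (integrable_exp_neg_mul_sq (by positivity)).const_mul _
  have inner : ∀ x : ℝ, ∫ t in Set.Ioc (0 : ℝ) T, F (x - t + c₀) ^ 2
      ≤ C ^ 2 * τ ^ (k + 1) * √(π / (τ / 2)) := by
    intro x
    have e : ∀ t, x - t + c₀ = (x + c₀) - t := fun t => by ring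
    simp_rw [e]
    have hg' := hg.comp_sub_left (x + c₀)
    calc ∫ t in Set.Ioc (0 : ℝ) T, F ((x + c₀) - t) ^ 2
        ≤ ∫ t in Set.Ioc (0 : ℝ) T,
            C ^ 2 * τ ^ (k + 1) * Real.exp (-(τ / 2) * ((x + c₀) - t) ^ 2) :=
          integral_mono_of_nonneg (Filter.Eventually.of_forall fun t => sq_nonneg _)
            hg'.integrableOn (Filter.Eventually.of_forall fun t => key _)
      _ ≤ ∫ t, C ^ 2 * τ ^ (k + 1) * Real.exp (-(τ / 2) * ((x + c₀) - t) ^ 2) :=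
          setIntegral_le_integral hg' (Filter.Eventually.of_forall fun t => by
            simp only [Pi.zero_apply]; positivity)
      _ = ∫ t, C ^ 2 * τ ^ (k + 1) * Real.exp (-(τ / 2) * t ^ 2) :=
          integral_sub_left_eq_self
            (fun t => C ^ 2 * τ ^ (k + 1) * Real.exp (-(τ / 2) * t ^ 2)) volume (x + c₀)
      _ = _ := by rw [integral_const_mul, integral_gaussian]
  have outer : ∫ x in Set.Ioo a b, ∫ t in Set.Ioc (0 : ℝ) T, F (x - t + c₀) ^ 2
      ≤ ∫ x in Set.Ioo a b, C ^ 2 * τ ^ (k + 1) * √(π / (τ / 2)) :=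
    integral_mono_of_nonneg
      (Filter.Eventually.of_forall fun x => integral_nonneg fun t => sq_nonneg _)
      (integrable_const _) (Filter.Eventually.of_forall inner)
  refine outer.trans ?_
  rw [setIntegral_const, Real.volume_real_Ioo_of_le hab.le, smul_eq_mul]
  have hq : τ ^ (k + 1) * √(π / (τ / 2)) = √(2 * π) * τ ^ ((k : ℝ) + 1 / 2) := by
    have h1 : π / (τ / 2) = (2 * π) / τ := by field_simp
    rw [h1, Real.sqrt_div (by positivity), Real.rpow_add hτ0, Real.rpow_natCast,
      ← Real.sqrt_eq_rpow, pow_succ]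
    have : √τ ≠ 0 := by positivity
    field_simp
    rw [hss]
  have hpos : 0 < τ ^ ((k : ℝ) + 1 / 2) := by positivity
  rw [mul_assoc (C ^ 2), hq]
  have := mul_pos hba hpos
  nlinarith
end

section
/- Let n ≥ 1, let α > 0, and let χ : ℝ → ℝ be smooth with compact support contained in [−α, α] and |χ| ≤ 1. For τ ≥ 1 define H_τ(l) = χ(l) · τ^{1/2} · e^{−τ l²/2}. Let Ω ⊂ ℝⁿ be a bounded open set, let T > 0, and let k ∈ ℕ. Then there exists a constant C > 0, depending on χ, Ω, T and k but not on τ, c₀ or θ, such that for all τ ≥ 1, all c₀ ∈ ℝ, and all unit vectors θ ∈ ℝⁿ: ∫_Ω ∫_0^T |H_τ^{(k)}(x·θ − t + c₀)|² dt dx ≤ C · τ^{k + 1/2}, where H_τ^{(k)} denotes the k-th derivative of H_τ. -/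
open MeasureTheory Real
open scoped RealInnerProductSpace

/-- Scaled model packet. -/
noncomputable def wpF (χ : ℝ → ℝ) (m : ℕ) (σ : ℝ) : ℝ → ℝ :=
  fun l => χ l * (σ * l) ^ m * Real.exp (-(σ * l) ^ 2 / 2)

lemma wpF_contDiff (χ : ℝ → ℝ) (hχ : ContDiff ℝ (⊤ : ℕ∞) χ) (m : ℕ) (σ : ℝ) :
    ContDiff ℝ (⊤ : ℕ∞) (wpF χ m σ) := by
  unfold wpF; fun_prop

lemma wpF_deriv (χ : ℝ → ℝ) (hχ : ContDiff ℝ (⊤ : ℕ∞) χ) (m : ℕ) (σ : ℝ) :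
    deriv (wpF χ m σ) = fun l => wpF (deriv χ) m σ l +
      (σ * m * wpF χ (m - 1) σ l + (-σ) * wpF χ (m + 1) σ l) := by
  funext l
  have h1 : HasDerivAt χ (deriv χ l) l :=
    (hχ.differentiable (by simp) l).hasDerivAt
  have h2 : HasDerivAt (fun l : ℝ => σ * l) σ l := by
    simpa using (hasDerivAt_id l).const_mul σ
  have h3 := h2.pow m
  have h4 := (((h2.pow 2).neg).div_const 2).exp
  have h5 := (h1.mul h3).mul h4
  have h6 : wpF χ m σ = ((χ * (fun l : ℝ => σ * l) ^ m) *
    fun x => Real.exp ((-(fun l : ℝ => σ * l) ^ 2) x / 2)) := by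
    funext x; simp [wpF]
  rw [h6, h5.deriv]
  simp [wpF]
  ring

lemma wp_pow_bound (m : ℕ) (s : ℝ) :
    |s| ^ m * Real.exp (-s ^ 2 / 2) ≤ (m.factorial * Real.exp 1) * Real.exp (-s ^ 2 / 4) := by
  have h1 : |s| ≤ 1 + s ^ 2 / 4 := by
    rw [← sq_abs s]; nlinarith [sq_nonneg (|s| - 2)]
  have h2 : |s| ^ m ≤ (1 + s ^ 2 / 4) ^ m := pow_le_pow_left₀ (abs_nonneg s) h1 m
  have h3 := Real.pow_div_factorial_le_exp (1 + s ^ 2 / 4) (by positivity) m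
  rw [div_le_iff₀ (by positivity)] at h3
  calc |s| ^ m * Real.exp (-s ^ 2 / 2)
      ≤ (Real.exp (1 + s ^ 2 / 4) * m.factorial) * Real.exp (-s ^ 2 / 2) := by
        gcongr; exact h2.trans h3
    _ = m.factorial * (Real.exp (1 + s ^ 2 / 4) * Real.exp (-s ^ 2 / 2)) := by ring
    _ = m.factorial * (Real.exp 1 * Real.exp (-s ^ 2 / 4)) := by
        rw [← Real.exp_add, ← Real.exp_add]; ring_nf
    _ = _ := by ring

lemma wpF_bound (k : ℕ) : ∀ (χ : ℝ → ℝ), ContDiff ℝ (⊤ : ℕ∞) χ → HasCompactSupport χ →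
    ∀ m : ℕ, ∃ C : ℝ, 0 ≤ C ∧ ∀ σ : ℝ, 1 ≤ σ → ∀ l : ℝ,
      |iteratedDeriv k (wpF χ m σ) l| ≤ C * σ ^ k * Real.exp (-(σ * l) ^ 2 / 4) := by
  induction k with
  | zero =>
    intro χ hχ hc m
    obtain ⟨B, hB⟩ := hc.exists_bound_of_continuous hχ.continuous
    have hB0 : 0 ≤ B := (norm_nonneg _).trans (hB 0)
    refine ⟨B * (m.factorial * Real.exp 1), by positivity, fun σ hσ l => ?_⟩
    simp only [iteratedDeriv_zero, wpF, abs_mul, abs_pow, pow_zero, mul_one, Real.abs_exp]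
    have := wp_pow_bound m (σ * l)
    rw [abs_mul] at this
    rw [mul_assoc, mul_assoc B]
    exact mul_le_mul (hB l) this (by positivity) hB0
  | succ k ih =>
    intro χ hχ hc m
    have hχ' : ContDiff ℝ (⊤ : ℕ∞) (deriv χ) := by
      have : ContDiff ℝ ((⊤ : ℕ∞) + 1) χ := hχ
      exact (contDiff_succ_iff_deriv.1 this).2.2
    obtain ⟨A, hA0, hA⟩ := ih (deriv χ) hχ' hc.deriv m
    obtain ⟨B, hB0, hB⟩ := ih χ hχ hc (m - 1)
    obtain ⟨D, hD0, hD⟩ := ih χ hχ hc (m + 1)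
    refine ⟨A + (m * B + D), by positivity, fun σ hσ l => ?_⟩
    have hs0 : 0 ≤ σ := by linarith
    have hle : ((k : ℕ) : WithTop ℕ∞) ≤ ((⊤ : ℕ∞) : WithTop ℕ∞) := by
      exact_mod_cast le_top
    have c1 : ContDiff ℝ k (wpF (deriv χ) m σ) := (wpF_contDiff _ hχ' m σ).of_le hle
    have c2 : ContDiff ℝ k (wpF χ (m - 1) σ) := (wpF_contDiff _ hχ _ σ).of_le hle
    have c3 : ContDiff ℝ k (wpF χ (m + 1) σ) := (wpF_contDiff _ hχ _ σ).of_le hle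
    have e : iteratedDeriv (k + 1) (wpF χ m σ) l = iteratedDeriv k (wpF (deriv χ) m σ) l +
        (σ * m * iteratedDeriv k (wpF χ (m - 1) σ) l
          + (-σ) * iteratedDeriv k (wpF χ (m + 1) σ) l) := by
      rw [iteratedDeriv_succ', wpF_deriv χ hχ, iteratedDeriv_fun_add (by fun_prop) (by fun_prop),
        iteratedDeriv_fun_add (by fun_prop) (by fun_prop), iteratedDeriv_const_mul_field,
        iteratedDeriv_const_mul_field]
    rw [e]
    set E := Real.exp (-(σ * l) ^ 2 / 4) with hE
    have hE0 : 0 < E := Real.exp_pos _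
    calc _ ≤ |iteratedDeriv k (wpF (deriv χ) m σ) l| +
          (σ * m * |iteratedDeriv k (wpF χ (m - 1) σ) l|
          + σ * |iteratedDeriv k (wpF χ (m + 1) σ) l|) := by
          refine (abs_add_le _ _).trans ?_
          gcongr
          refine (abs_add_le _ _).trans (le_of_eq ?_)
          rw [abs_mul, abs_mul, abs_mul, abs_neg, abs_of_nonneg hs0, Nat.abs_cast]
      _ ≤ A * σ ^ k * E + (σ * m * (B * σ ^ k * E) + σ * (D * σ ^ k * E)) := by
          gcongr
          · exact hA σ hσ l
          · exact hB σ hσ l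
          · exact hD σ hσ l
      _ ≤ A * σ ^ (k + 1) * E + (σ * m * (B * σ ^ k * E) + σ * (D * σ ^ k * E)) := by
          gcongr
          omega
      _ = _ := by ring

/-- **`L²` space–time estimate for derivatives of Gaussian plane-wave packets
(`n+1` dimensions).** Let `χ` be smooth, supported in `[-α, α]`, with
`|χ| ≤ 1`, and for `τ ≥ 1` let `H_τ(l) = χ(l) τ^{1/2} e^{-τl²/2}`. Then for a
bounded open set `Ω ⊆ ℝⁿ`, a time `T > 0` and `k ∈ ℕ`, there is `C > 0`
independent of `τ ≥ 1`, of the shift `c₀` and of the unit direction `θ` such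
that `∫_Ω ∫_0^T |H_τ^{(k)}(x·θ - t + c₀)|² dt dx ≤ C τ^{k + 1/2}`. -/
theorem wave_packet_L2_estimate_nD
    (n : ℕ) (hn : 1 ≤ n)
    (α : ℝ) (hα : 0 < α) (χ : ℝ → ℝ) (hχ : ContDiff ℝ (⊤ : ℕ∞) χ)
    (hχsupp : Function.support χ ⊆ Set.Icc (-α) α)
    (hχbd : ∀ l : ℝ, |χ l| ≤ 1)
    (Ω : Set (EuclideanSpace ℝ (Fin n))) (hΩo : IsOpen Ω)
    (hΩb : Bornology.IsBounded Ω)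
    (T : ℝ) (hT : 0 < T) (k : ℕ) :
    ∃ C : ℝ, 0 < C ∧ ∀ τ : ℝ, 1 ≤ τ → ∀ c₀ : ℝ,
      ∀ θ : EuclideanSpace ℝ (Fin n), ‖θ‖ = 1 →
      ∫ x in Ω, ∫ t in Set.Ioc (0 : ℝ) T,
          (iteratedDeriv k
              (fun l : ℝ => χ l * τ ^ ((1 : ℝ) / 2) * Real.exp (-τ * l ^ 2 / 2))
              (⟪x, θ⟫ - t + c₀)) ^ 2
        ≤ C * τ ^ ((k : ℝ) + 1 / 2) := by

  have hc : HasCompactSupport χ :=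
    HasCompactSupport.of_support_subset_isCompact isCompact_Icc hχsupp
  obtain ⟨B, hB0, hB⟩ := wpF_bound k χ hχ hc 0
  refine ⟨B ^ 2 * √(2 * π) * (volume.real Ω + 1) + 1, by positivity, fun τ hτ c₀ θ hθ => ?_⟩
  have hτ0 : 0 < τ := by linarith
  set σ := √τ with hσdef
  have hσ : 1 ≤ σ := Real.one_le_sqrt.2 hτ
  have hσ2 : σ ^ 2 = τ := Real.sq_sqrt hτ0.le
  set P := τ ^ ((k : ℝ) + 1 / 2) with hP
  have hP0 : 0 < P := Real.rpow_pos_of_pos hτ0 _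
  have hfun : (fun l : ℝ => χ l * τ ^ ((1 : ℝ) / 2) * Real.exp (-τ * l ^ 2 / 2)) =
      fun l => σ * wpF χ 0 σ l := by
    funext l
    simp only [wpF, pow_zero, mul_one, mul_pow, hσ2, ← Real.sqrt_eq_rpow]
    rw [← hσdef, neg_mul]; ring
  have hpt : ∀ l : ℝ, (iteratedDeriv k (fun l : ℝ => χ l * τ ^ ((1 : ℝ) / 2) *
      Real.exp (-τ * l ^ 2 / 2)) l) ^ 2 ≤ B ^ 2 * τ ^ (k + 1) * Real.exp (-(τ / 2) * l ^ 2) := by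
    intro l
    rw [hfun, iteratedDeriv_const_mul_field, mul_pow, hσ2, ← sq_abs (iteratedDeriv _ _ _)]
    calc _ ≤ τ * (B * σ ^ k * Real.exp (-(σ * l) ^ 2 / 4)) ^ 2 := by
          gcongr; exact hB σ hσ l
      _ = B ^ 2 * (τ * (σ ^ 2) ^ k) * (Real.exp (-(σ * l) ^ 2 / 4)) ^ 2 := by ring
      _ = _ := by
          rw [hσ2, sq (Real.exp _), ← Real.exp_add, mul_pow, hσ2, pow_succ']
          congr 2 <;> ring
  have hint : Integrable (fun l : ℝ => B ^ 2 * τ ^ (k + 1) * Real.exp (-(τ / 2) * l ^ 2)) :=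
    (integrable_exp_neg_mul_sq (by positivity)).const_mul _
  have hval : ∫ l : ℝ, B ^ 2 * τ ^ (k + 1) * Real.exp (-(τ / 2) * l ^ 2) =
      B ^ 2 * √(2 * π) * P := by
    rw [integral_const_mul, integral_gaussian]
    have e1 : √(π / (τ / 2)) = √(2 * π) / σ := by
      rw [hσdef, ← Real.sqrt_div (by positivity)]; congr 1; field_simp
    have e2 : P = τ ^ k * σ := by
      rw [hP, Real.rpow_add hτ0, Real.rpow_natCast, ← Real.sqrt_eq_rpow]
    rw [e1, e2, pow_succ, ← hσ2]
    have : σ ≠ 0 := by positivity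
    field_simp
    ring
  have hinner : ∀ a : ℝ, ∫ t in Set.Ioc (0 : ℝ) T, (iteratedDeriv k (fun l : ℝ => χ l *
      τ ^ ((1 : ℝ) / 2) * Real.exp (-τ * l ^ 2 / 2)) (a - t)) ^ 2 ≤ B ^ 2 * √(2 * π) * P := by
    intro a
    have hi2 := hint.comp_sub_left a
    calc _ ≤ ∫ t in Set.Ioc (0 : ℝ) T, B ^ 2 * τ ^ (k + 1) * Real.exp (-(τ / 2) * (a - t) ^ 2) := by
          refine integral_mono_of_nonneg (.of_forall fun t => sq_nonneg _) hi2.integrableOn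
            (.of_forall fun t => hpt _)
      _ ≤ ∫ t, B ^ 2 * τ ^ (k + 1) * Real.exp (-(τ / 2) * (a - t) ^ 2) :=
          setIntegral_le_integral hi2 (.of_forall fun t => by positivity)
      _ = _ := by
          rw [integral_sub_left_eq_self
            (fun l : ℝ => B ^ 2 * τ ^ (k + 1) * Real.exp (-(τ / 2) * l ^ 2)) volume a, hval]
  have hfin : volume Ω < ⊤ := hΩb.measure_lt_top
  have hout := norm_setIntegral_le_of_norm_le_const (μ := volume) (s := Ω)
    (f := fun x => ∫ t in Set.Ioc (0 : ℝ) T, (iteratedDeriv k (fun l : ℝ => χ l *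
      τ ^ ((1 : ℝ) / 2) * Real.exp (-τ * l ^ 2 / 2)) (⟪x, θ⟫ - t + c₀)) ^ 2)
    (C := B ^ 2 * √(2 * π) * P) hfin (fun x _ => by
      rw [Real.norm_of_nonneg (integral_nonneg fun t => sq_nonneg _)]
      have := hinner (⟪x, θ⟫ + c₀)
      simpa only [add_sub_right_comm] using this)
  refine (le_abs_self _).trans (hout.trans ?_)
  have h0 : 0 ≤ B ^ 2 * √(2 * π) * P := by positivity
  nlinarith [measureReal_nonneg (μ := volume) (s := Ω)]
end

section
/- Let n ≥ 1, let Ω ⊂ ℝⁿ be a bounded open set, let x₀ ∈ ℝⁿ and d > 0 be such that Ω is contained in the ball of radius d/2 centered at x₀, let λ > 0, let T ≥ 2d + 2λ, and set t₁ = d + λ and t₂ = T − d − λ. Then there exists a smooth function v : ℝⁿ × ℝ → ℝ such that: (i) v solves the wave equation ∂_t² v = Δ_x v on all of ℝⁿ × ℝ; (ii) v(x, t) = 1 for every x ∈ Ω and every t ∈ [t₁, t₂]; and (iii) there exists r > 0 such that v(x, t) = 0 for every x ∈ Ω and every t ∈ [T − r, T]; in particular v(·, T) = 0 and ∂_t v(·,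 T) = 0 on Ω. -/
open Real MeasureTheory

theorem aux_fderiv {n : ℕ} (g : ℝ → ℝ) (hg : Differentiable ℝ g) (i0 : Fin n) (t : ℝ)
    (y w : EuclideanSpace ℝ (Fin n)) :
    fderiv ℝ (fun z : EuclideanSpace ℝ (Fin n) => g (z i0 - t)) y w = deriv g (y i0 - t) * w i0 := by
  have h1 : HasFDerivAt (fun z : EuclideanSpace ℝ (Fin n) => z i0 - t)
      (EuclideanSpace.proj i0 : EuclideanSpace ℝ (Fin n) →L[ℝ] ℝ) y :=
    ((EuclideanSpace.proj i0 : EuclideanSpace ℝ (Fin n) →L[ℝ] ℝ).hasFDerivAt).sub_const t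
  have h2 := (hg (y i0 - t)).hasDerivAt.comp_hasFDerivAt y h1
  have h3 := h2.fderiv
  have h4 : fderiv ℝ (fun z : EuclideanSpace ℝ (Fin n) => g (z i0 - t)) y = _ := h3
  rw [h4]
  simp

theorem aux_deriv (g : ℝ → ℝ) (a : ℝ) :
    deriv (fun s : ℝ => g (a - s)) = fun s => - deriv g (a - s) := by
  funext s
  exact deriv_comp_const_sub ..

/-- **Existence of the measurement-generating wave.** Let `Ω ⊆ ℝⁿ` be a
bounded open set contained in the ball of radius `d/2` about `x₀`, let
`lam > 0`, `T ≥ 2d + 2·lam`, and set `t₁ = d + lam`, `t₂ = T - d - lam`.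
Then there is a smooth `v : ℝⁿ × ℝ → ℝ` such that: (i) `v` solves the wave
equation `∂_t²v = Δ_x v` everywhere (the Laplacian being the sum of second
directional derivatives along the standard orthonormal basis); (ii) `v ≡ 1`
on `Ω × [t₁, t₂]`; and (iii) for some `r > 0`, `v ≡ 0` on `Ω × [T - r, T]`;
in particular `v(·, T) = 0` and `∂_t v(·, T) = 0` on `Ω`. -/
theorem exists_measurement_wave
    (n : ℕ) (hn : 1 ≤ n)
    (Ω : Set (EuclideanSpace ℝ (Fin n))) (hΩo : IsOpen Ω)
    (hΩb : Bornology.IsBounded Ω)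
    (x₀ : EuclideanSpace ℝ (Fin n)) (d lam T : ℝ)
    (hd : 0 < d) (hΩ : Ω ⊆ Metric.ball x₀ (d / 2))
    (hlam : 0 < lam) (hT : 2 * d + 2 * lam ≤ T) :
    ∃ v : EuclideanSpace ℝ (Fin n) × ℝ → ℝ,
      ContDiff ℝ (⊤ : ℕ∞) v ∧
      (∀ x : EuclideanSpace ℝ (Fin n), ∀ t : ℝ,
        deriv (deriv (fun s : ℝ => v (x, s))) t
          = ∑ i : Fin n,
              fderiv ℝ
                (fun y : EuclideanSpace ℝ (Fin n) =>
                  fderiv ℝ (fun z : EuclideanSpace ℝ (Fin n) => v (z, t)) y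
                    (EuclideanSpace.single i (1 : ℝ)))
                x (EuclideanSpace.single i (1 : ℝ))) ∧
      (∀ x ∈ Ω, ∀ t ∈ Set.Icc (d + lam) (T - d - lam), v (x, t) = 1) ∧
      (∃ r : ℝ, 0 < r ∧ ∀ x ∈ Ω, ∀ t ∈ Set.Icc (T - r) T, v (x, t) = 0) ∧
      (∀ x ∈ Ω, v (x, T) = 0 ∧ deriv (fun s : ℝ => v (x, s)) T = 0) := by
  have key : ∃ f : ℝ → ℝ, ContDiff ℝ (⊤ : ℕ∞) f ∧
      (∀ u, x₀ ⟨0, hn⟩ - T + d / 2 + lam ≤ u → f u = 1) ∧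
      (∀ u, u ≤ x₀ ⟨0, hn⟩ - T + d / 2 + lam / 2 → f u = 0) := by
    refine ⟨fun u => smoothTransition ((u - (x₀ ⟨0, hn⟩ - T + d / 2 + lam / 2)) / (lam / 2)),
      ?_, ?_, ?_⟩
    · exact smoothTransition.contDiff.comp ((contDiff_id.sub contDiff_const).div_const _)
    · intro u hu
      apply smoothTransition.one_of_one_le
      rw [le_div_iff₀ (by linarith)]
      linarith
    · intro u hu
      apply smoothTransition.zero_of_nonpos
      exact div_nonpos_of_nonpos_of_nonneg (by linarith) (by linarith)
  obtain ⟨f, hf, hf1, hf0⟩ := key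
  generalize (⟨0, hn⟩ : Fin n) = i0 at hf1 hf0
  have hfd : Differentiable ℝ f := hf.differentiable (by simp)
  have hfd' : Differentiable ℝ (deriv f) :=
    ((contDiff_infty_iff_deriv.1 hf).2).differentiable (by simp)
  have hco : ∀ x ∈ Ω, |x i0 - x₀ i0| < d / 2 := by
    intro x hx
    have h := hΩ hx
    rw [Metric.mem_ball, dist_eq_norm] at h
    have h2 := PiLp.norm_apply_le (x - x₀) i0
    simp only [PiLp.sub_apply, Real.norm_eq_abs] at h2
    linarith
  have hz : ∀ x ∈ Ω, ∀ t, T - lam / 2 ≤ t → f (x i0 - t) = 0 := by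
    intro x hx t ht
    have := (abs_lt.1 (hco x hx)).2
    exact hf0 _ (by linarith)
  refine ⟨fun p => f (p.1 i0 - p.2), ?_, ?_, ?_, ⟨lam / 2, by linarith, ?_⟩, ?_⟩
  · refine hf.comp (ContDiff.sub ?_ contDiff_snd)
    exact (EuclideanSpace.proj i0 : EuclideanSpace ℝ (Fin n) →L[ℝ] ℝ).contDiff.comp contDiff_fst
  · intro x t
    simp only [aux_fderiv f hfd]
    have h1 : ∀ i : Fin n, fderiv ℝ (fun y : EuclideanSpace ℝ (Fin n) =>
        deriv f (y i0 - t) * (EuclideanSpace.single i (1 : ℝ) : EuclideanSpace ℝ (Fin n)) i0) x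
          (EuclideanSpace.single i (1 : ℝ)) = if i0 = i then deriv (deriv f) (x i0 - t) else 0 := by
      intro i
      rw [aux_fderiv (fun u => deriv f u *
        (EuclideanSpace.single i (1 : ℝ) : EuclideanSpace ℝ (Fin n)) i0) (hfd'.mul_const _)]
      by_cases h : i0 = i
      · subst h; simp
      · simp [h]
    simp only [h1]
    rw [aux_deriv, deriv.fun_neg, aux_deriv]
    simp
  · intro x hx t ht
    have := (abs_lt.1 (hco x hx)).1
    exact hf1 _ (by linarith [ht.2])
  · intro x hx t ht
    exact hz x hx t ht.1
  · intro x hx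
    refine ⟨hz x hx T (by linarith), ?_⟩
    have : (fun s : ℝ => f (x i0 - s)) =ᶠ[nhds T] fun _ => 0 := by
      filter_upwards [lt_mem_nhds (show T - lam / 2 < T by linarith)] with s hs
      exact hz x hx s hs.le
    exact this.deriv_eq.trans (by simp)
end
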